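/- Let G be a hereditary modular graph with basepoint ∗, and let v and v' be adjacent vertices with d(∗,v') = d(∗,v) + 1 such that the intervals I(∗,v) and I(∗,v') are K_{2,3}-free. Then for every n ∈ ℕ, ‖f_{n,v} − f_{n,v'}‖₁ = Σ_w |f_{n,v}(w) − f_{n,v'}(w)| = 2(n+1). -/

import Mathlib

/-- A connected graph is modular if every triple of vertices has a median. -/
def Modular {W : Type*} (G : SimpleGraph W) : Prop :=
  G.Connected ∧ ∀ u v w : W, ∃ m : W,
    G.dist u m + G.dist m v = G.dist u v ∧
    G.dist u m + G.dist m w = G.dist u w ∧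
    G.dist v m + G.dist m w = G.dist v w

/-- A connected graph is hereditary modular if every connected isometric subgraph
of it is modular. -/
def HereditaryModular {V : Type*} (G : SimpleGraph V) : Prop :=
  G.Connected ∧ ∀ H : G.Subgraph, H.Connected →
    (∀ x y : H.verts, H.coe.dist x y = G.dist x.1 y.1) → Modular H.coe

/-- The interval `I(u,v)`: the set of vertices lying on geodesics from `u` to `v`. -/
def interval {V : Type*} (G : SimpleGraph V) (u v : V) : Set V :=
  {w | G.dist u w + G.dist w v = G.dist u v}

/-- A graph is `K_{2,3}`-free if there are no five distinct vertices
`a₀, a₁, b₀, b₁, b₂` with `aᵢ` adjacent to `bⱼ` for all `i`, `j`. -/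
def K23Free {W : Type*} (G : SimpleGraph W) : Prop :=
  ¬ ∃ a₀ a₁ b₀ b₁ b₂ : W, a₀ ≠ a₁ ∧ b₀ ≠ b₁ ∧ b₀ ≠ b₂ ∧ b₁ ≠ b₂ ∧
    G.Adj a₀ b₀ ∧ G.Adj a₀ b₁ ∧ G.Adj a₀ b₂ ∧
    G.Adj a₁ b₀ ∧ G.Adj a₁ b₁ ∧ G.Adj a₁ b₂

/-- `rho G b v w` is the number of vertices `x ∈ I(b,v)` adjacent to `w` with
`d(b,x) = d(b,w) - 1`. -/
noncomputable def rho {V : Type*} (G : SimpleGraph V) (b v w : V) : ℕ :=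
  {x | x ∈ interval G b v ∧ G.Adj w x ∧ G.dist b x + 1 = G.dist b w}.ncard

open Classical in
/-- The weight function of Brodzki–Campbell–Guentner–Niblo–Wright. -/
noncomputable def weight {V : Type*} (G : SimpleGraph V) (b v : V) (n : ℕ) (w : V) : ℕ :=
  if w ∉ interval G b v ∨ n < G.dist w v then 0
  else if 2 ≤ rho G b v w then 1
  else if rho G b v w = 1 then n - G.dist w v + 1
  else (n - G.dist w v + 2) * (n - G.dist w v + 1) / 2

/-- The neighbours of `w` one step closer to `b`. -/
def lowerNeighbors {V : Type*} (G : SimpleGraph V) (b w : V) : Set V :=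
  {x | G.Adj w x ∧ G.dist b x + 1 = G.dist b w}

/-- An explicit form of modularity, without the connectedness requirement. -/
def HasMedians {V : Type*} (G : SimpleGraph V) : Prop :=
  ∀ u v w : V, ∃ m : V,
    G.dist u m + G.dist m v = G.dist u v ∧
    G.dist u m + G.dist m w = G.dist u w ∧
    G.dist v m + G.dist m w = G.dist v w

section Distance

variable {V : Type*} {G : SimpleGraph V}

lemma exists_adj_dist_succ (hc : G.Connected) {u w : V} {k : ℕ} (h : G.dist u w = k + 1) :
    ∃ z, G.Adj w z ∧ G.dist u z = k := by
  obtain ⟨p, hp⟩ := hc.exists_walk_length_eq_dist w u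
  rw [SimpleGraph.dist_comm, h] at hp
  cases p with
  | nil => simp at hp
  | cons hadj q =>
    rename_i z
    refine ⟨z, hadj, ?_⟩
    have h1 : G.dist z u ≤ q.length := SimpleGraph.dist_le q
    have h2 := hc.dist_triangle (u := u) (v := z) (w := w)
    have h3 : G.dist z w = 1 := SimpleGraph.dist_eq_one_iff_adj.2 hadj.symm
    rw [SimpleGraph.Walk.length_cons] at hp
    rw [SimpleGraph.dist_comm] at h1
    omega

lemma dist_ne_of_adj (hm : HasMedians G) (u : V) {x y : V}
    (h : G.Adj x y) : G.dist u x ≠ G.dist u y := by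
  obtain ⟨m, h1, h2, h3⟩ := hm u x y
  have hxy : G.dist x y = 1 := SimpleGraph.dist_eq_one_iff_adj.2 h
  intro he
  rw [G.dist_comm (u := m) (v := x)] at h1
  omega

lemma dist_le_succ_of_adj (hc : G.Connected) (u : V) {x y : V}
    (h : G.Adj x y) : G.dist u y ≤ G.dist u x + 1 := by
  have := hc.dist_triangle (u := u) (v := x) (w := y)
  rwa [SimpleGraph.dist_eq_one_iff_adj.2 h] at this

lemma dist_eq_two (hm : HasMedians G) (hc : G.Connected) {u x y z : V}
    (hxy : x ≠ y) (hx : G.Adj z x) (hy : G.Adj z y) (h : G.dist u x = G.dist u y) :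
    G.dist x y = 2 := by
  have h1 := dist_le_succ_of_adj hc x hy
  rw [SimpleGraph.dist_eq_one_iff_adj.2 hx.symm] at h1
  have h2 : 0 < G.dist x y := hc.pos_dist_of_ne hxy
  have h3 : G.dist x y ≠ 1 := fun h' =>
    dist_ne_of_adj hm u (SimpleGraph.dist_eq_one_iff_adj.1 h') h
  omega

/-- A set in which one can always step closer, inside the set, to a given element of it
induces an isometric subgraph. -/
lemma dist_induce_eq (hc : G.Connected) (s : Set V)
    (hs : ∀ x ∈ s, ∀ y ∈ s, x ≠ y → ∃ z ∈ s, G.Adj y z ∧ G.dist x z + 1 = G.dist x y)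
    (x y : ((⊤ : G.Subgraph).induce s).verts) :
    ((⊤ : G.Subgraph).induce s).coe.Reachable x y ∧
      ((⊤ : G.Subgraph).induce s).coe.dist x y = G.dist x.1 y.1 := by
  have key : ∀ k, ∀ y : ((⊤ : G.Subgraph).induce s).verts, G.dist x.1 y.1 = k →
      ∃ p : ((⊤ : G.Subgraph).induce s).coe.Walk y x, p.length = k := by
    intro k
    induction k with
    | zero =>
      intro y hy
      obtain rfl : x = y := Subtype.ext ((hc.dist_eq_zero_iff).1 hy)
      exact ⟨.nil, rfl⟩
    | succ k ih =>
      intro y hy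
      obtain ⟨z, hz, hadj, hd⟩ := hs x.1 x.2 y.1 y.2 (by
        intro h
        rw [h, SimpleGraph.dist_self] at hy
        omega)
      obtain ⟨p, hp⟩ := ih ⟨z, hz⟩ (by simp only; omega)
      have hyz : ((⊤ : G.Subgraph).induce s).coe.Adj y ⟨z, hz⟩ := ⟨y.2, hz, hadj⟩
      exact ⟨.cons hyz p, by simp [hp]⟩
  obtain ⟨p, hp⟩ := key _ y rfl
  refine ⟨p.reachable.symm, le_antisymm ?_ ?_⟩
  · rw [← hp, SimpleGraph.dist_comm]
    exact SimpleGraph.dist_le p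
  · obtain ⟨q, hq⟩ := p.reachable.symm.exists_walk_length_eq_dist
    rw [← hq, ← SimpleGraph.Walk.length_map ((⊤ : G.Subgraph).induce s).hom q]
    exact SimpleGraph.dist_le _

lemma HereditaryModular.exists_median_mem (hG : HereditaryModular G) (s : Set V)
    (hs : ∀ x ∈ s, ∀ y ∈ s, x ≠ y → ∃ z ∈ s, G.Adj y z ∧ G.dist x z + 1 = G.dist x y)
    {u v w : V} (hu : u ∈ s) (hv : v ∈ s) (hw : w ∈ s) : ∃ m ∈ s,
      G.dist u m + G.dist m v = G.dist u v ∧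
      G.dist u m + G.dist m w = G.dist u w ∧
      G.dist v m + G.dist m w = G.dist v w := by
  have hd := dist_induce_eq hG.1 s hs
  have hconn : ((⊤ : G.Subgraph).induce s).Connected :=
    ⟨by
      have : Nonempty ((⊤ : G.Subgraph).induce s).verts := ⟨⟨u, hu⟩⟩
      exact ⟨fun x y => (hd x y).1⟩⟩
  obtain ⟨m, h1, h2, h3⟩ := (hG.2 _ hconn fun x y => (hd x y).2).2 ⟨u, hu⟩ ⟨v, hv⟩ ⟨w, hw⟩
  simp only [(hd _ _).2] at h1 h2 h3
  exact ⟨m.1, m.2, h1, h2, h3⟩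

lemma HereditaryModular.hasMedians (hG : HereditaryModular G) : HasMedians G := by
  intro u v w
  obtain ⟨m, -, h⟩ := hG.exists_median_mem Set.univ (fun x _ y _ hxy => by
    have h := hG.1.pos_dist_of_ne hxy
    obtain ⟨z, hz, hd⟩ := exists_adj_dist_succ hG.1
      (show G.dist x y = (G.dist x y - 1) + 1 by omega)
    exact ⟨z, trivial, hz, by omega⟩) (Set.mem_univ u) (Set.mem_univ v) (Set.mem_univ w)
  exact ⟨m, h⟩

/-- A hereditary modular graph has no isometric hexagon. -/
lemma HereditaryModular.not_isometric_hexagon (hG : HereditaryModular G)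
    {x₁ x₂ x₃ y₁ y₂ y₃ : V}
    (h12 : G.Adj x₁ y₂) (h13 : G.Adj x₁ y₃) (h21 : G.Adj x₂ y₁) (h23 : G.Adj x₂ y₃)
    (h31 : G.Adj x₃ y₁) (h32 : G.Adj x₃ y₂)
    (dx12 : G.dist x₁ x₂ = 2) (dx13 : G.dist x₁ x₃ = 2) (dx23 : G.dist x₂ x₃ = 2)
    (dy12 : G.dist y₁ y₂ = 2) (dy13 : G.dist y₁ y₃ = 2) (dy23 : G.dist y₂ y₃ = 2)
    (d1 : G.dist x₁ y₁ = 3) (d2 : G.dist x₂ y₂ = 3) (d3 : G.dist x₃ y₃ = 3) : False := by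
  have e12 := SimpleGraph.dist_eq_one_iff_adj.2 h12
  have e13 := SimpleGraph.dist_eq_one_iff_adj.2 h13
  have e21 := SimpleGraph.dist_eq_one_iff_adj.2 h21
  have e23 := SimpleGraph.dist_eq_one_iff_adj.2 h23
  have e31 := SimpleGraph.dist_eq_one_iff_adj.2 h31
  have e32 := SimpleGraph.dist_eq_one_iff_adj.2 h32
  have c := fun u v => G.dist_comm (u := u) (v := v)
  obtain ⟨m, hm, m1, m2, m3⟩ := hG.exists_median_mem {x₁, x₂, x₃, y₁, y₂, y₃} (by
    intro x hx y hy hxy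
    simp only [Set.mem_insert_iff, Set.mem_singleton_iff] at hx hy
    simp only [Set.mem_insert_iff, Set.mem_singleton_iff, exists_eq_or_imp, exists_eq_left]
    rcases hx with rfl | rfl | rfl | rfl | rfl | rfl <;>
    rcases hy with rfl | rfl | rfl | rfl | rfl | rfl <;>
    simp_all [SimpleGraph.adj_comm, SimpleGraph.dist_comm, -SimpleGraph.dist_eq_one_iff_adj])
    (u := x₁) (v := x₂) (w := x₃) (by simp) (by simp) (by simp)
  simp only [Set.mem_insert_iff, Set.mem_singleton_iff] at hm
  have := c x₁ x₂
  have := c x₁ x₃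
  have := c x₂ x₃
  have := c x₁ y₁
  have := c x₂ y₂
  have := c x₃ y₃
  rcases hm with rfl | rfl | rfl | rfl | rfl | rfl <;> omega

end Distance

section Interval

variable {V : Type*} {G : SimpleGraph V} {b v : V}

lemma interval_comm (G : SimpleGraph V) (b v : V) : interval G v b = interval G b v := by
  ext w
  simp only [interval, Set.mem_ofPred_eq, G.dist_comm (u := v), G.dist_comm (v := b)]
  rw [add_comm]

lemma K23Free.false_of_mem {s : Set V} (hK : K23Free (G.induce s)) {a₀ a₁ b₀ b₁ b₂ : V}
    (ha₀ : a₀ ∈ s) (ha₁ : a₁ ∈ s) (hb₀ : b₀ ∈ s) (hb₁ : b₁ ∈ s) (hb₂ : b₂ ∈ s)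
    (ha : a₀ ≠ a₁) (h01 : b₀ ≠ b₁) (h02 : b₀ ≠ b₂) (h12 : b₁ ≠ b₂)
    (e00 : G.Adj a₀ b₀) (e01 : G.Adj a₀ b₁) (e02 : G.Adj a₀ b₂)
    (e10 : G.Adj a₁ b₀) (e11 : G.Adj a₁ b₁) (e12 : G.Adj a₁ b₂) : False :=
  hK ⟨⟨a₀, ha₀⟩, ⟨a₁, ha₁⟩, ⟨b₀, hb₀⟩, ⟨b₁, hb₁⟩, ⟨b₂, hb₂⟩, by simpa using ha,
    by simpa using h01, by simpa using h02, by simpa using h12, e00, e01, e02, e10, e11, e12⟩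

lemma mem_interval_of_mem_lowerNeighbors (hc : G.Connected) {w x : V}
    (hw : w ∈ interval G b v) (hx : x ∈ lowerNeighbors G b w) :
    x ∈ interval G b v ∧ G.dist x v = G.dist w v + 1 := by
  obtain ⟨hadj, hd⟩ := hx
  have h1 := dist_le_succ_of_adj hc v hadj
  have h2 := hc.dist_triangle (u := b) (v := x) (w := v)
  rw [G.dist_comm (u := v), G.dist_comm (u := v)] at h1
  simp only [interval, Set.mem_ofPred_eq] at hw ⊢
  omega

lemma lowerNeighbors_nonempty (hc : G.Connected) {w : V} (h : w ≠ b) :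
    (lowerNeighbors G b w).Nonempty := by
  have h1 := hc.pos_dist_of_ne h.symm
  obtain ⟨z, hz, hd⟩ := exists_adj_dist_succ hc
    (show G.dist b w = (G.dist b w - 1) + 1 by omega)
  exact ⟨z, hz, by omega⟩

lemma exists_common_lowerNeighbor (hm : HasMedians G) (hc : G.Connected) {w x y : V}
    (hxy : x ≠ y) (hx : x ∈ lowerNeighbors G b w) (hy : y ∈ lowerNeighbors G b w) :
    ∃ z, z ∈ lowerNeighbors G b x ∧ z ∈ lowerNeighbors G b y := by
  have h2 := dist_eq_two (u := b) hm hc hxy hx.1 hy.1 (by have := hx.2; have := hy.2; omega)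
  obtain ⟨m, h3, h4, h5⟩ := hm x y b
  have hx2 := hx.2
  have hy2 := hy.2
  rw [G.dist_comm (u := m) (v := y)] at h3
  rw [G.dist_comm (u := m) (v := b), G.dist_comm (v := b)] at h4 h5
  exact ⟨m, ⟨SimpleGraph.dist_eq_one_iff_adj.1 (by omega), by omega⟩,
    ⟨SimpleGraph.dist_eq_one_iff_adj.1 (by omega), by omega⟩⟩

/-- Two vertices with a common upper neighbour have at most one common lower neighbour. -/
lemma eq_of_mem_lowerNeighbors (hc : G.Connected)
    (hK : K23Free (G.induce (interval G b v))) {w x y z z' : V} (hw : w ∈ interval G b v)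
    (hxy : x ≠ y) (hx : x ∈ lowerNeighbors G b w) (hy : y ∈ lowerNeighbors G b w)
    (hz : z ∈ lowerNeighbors G b x ∧ z ∈ lowerNeighbors G b y)
    (hz' : z' ∈ lowerNeighbors G b x ∧ z' ∈ lowerNeighbors G b y) : z = z' := by
  by_contra hne
  have ix := (mem_interval_of_mem_lowerNeighbors hc hw hx).1
  have iy := (mem_interval_of_mem_lowerNeighbors hc hw hy).1
  have iz := (mem_interval_of_mem_lowerNeighbors hc ix hz.1).1
  have iz' := (mem_interval_of_mem_lowerNeighbors hc ix hz'.1).1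
  have hne' : ∀ {t}, t ∈ lowerNeighbors G b x → w ≠ t := by
    rintro t ht rfl
    have := ht.2
    have := hx.2
    omega
  exact hK.false_of_mem ix iy hw iz iz' hxy (hne' hz.1) (hne' hz'.1) hne
    hx.1.symm hz.1.1 hz'.1.1 hy.1.symm hz.2.1 hz'.2.1

lemma lowerNeighbors_not_three (hG : HereditaryModular G)
    (hK : K23Free (G.induce (interval G b v))) {w x₁ x₂ x₃ : V} (hw : w ∈ interval G b v)
    (h1 : x₁ ∈ lowerNeighbors G b w) (h2 : x₂ ∈ lowerNeighbors G b w)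
    (h3 : x₃ ∈ lowerNeighbors G b w) (h12 : x₁ ≠ x₂) (h13 : x₁ ≠ x₃) (h23 : x₂ ≠ x₃) :
    False := by
  have hc := hG.1
  have hm := hG.hasMedians
  obtain ⟨y₃, y31, y32⟩ := exists_common_lowerNeighbor hm hc h12 h1 h2
  obtain ⟨y₂, y21, y23⟩ := exists_common_lowerNeighbor hm hc h13 h1 h3
  obtain ⟨y₁, y12, y13⟩ := exists_common_lowerNeighbor hm hc h23 h2 h3
  have i1 := (mem_interval_of_mem_lowerNeighbors hc hw h1).1
  have i2 := (mem_interval_of_mem_lowerNeighbors hc hw h2).1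
  have i3 := (mem_interval_of_mem_lowerNeighbors hc hw h3).1
  have j1 := (mem_interval_of_mem_lowerNeighbors hc i2 y12).1
  have j2 := (mem_interval_of_mem_lowerNeighbors hc i1 y21).1
  have j3 := (mem_interval_of_mem_lowerNeighbors hc i1 y31).1
  have l1 := h1.2
  have l2 := h2.2
  have l3 := h3.2
  have m1 := y12.2
  have m2 := y21.2
  have m3 := y31.2
  have notAll : ∀ {y}, y ∈ interval G b v → G.dist b y + 2 = G.dist b w →
      G.Adj x₁ y → G.Adj x₂ y → G.Adj x₃ y → False := by
    intro y hy hl a1 a2 a3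
    refine hK.false_of_mem hw hy i1 i2 i3 ?_ h12 h13 h23 h1.1 h2.1 h3.1 a1.symm a2.symm a3.symm
    rintro rfl
    omega
  have n12 : y₁ ≠ y₂ := by
    rintro rfl
    exact notAll j1 (by omega) y21.1 y12.1 y13.1
  have n13 : y₁ ≠ y₃ := by
    rintro rfl
    exact notAll j1 (by omega) y31.1 y12.1 y13.1
  have n23 : y₂ ≠ y₃ := by
    rintro rfl
    exact notAll j2 (by omega) y21.1 y32.1 y23.1
  have d12 := dist_eq_two (u := b) hm hc h12 h1.1 h2.1 (by omega)
  have d13 := dist_eq_two (u := b) hm hc h13 h1.1 h3.1 (by omega)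
  have d23 := dist_eq_two (u := b) hm hc h23 h2.1 h3.1 (by omega)
  have opposite : ∀ {x x' y}, G.dist x x' = 2 → G.Adj x' y → ¬ G.Adj x y →
      G.dist b y < G.dist b x → G.dist x y = 3 := by
    intro x x' y hd ha hn hl
    have e1 := dist_le_succ_of_adj hc x ha
    have e2 := dist_ne_of_adj hm x ha
    have e3 : G.dist x y ≠ 1 := fun h => hn (SimpleGraph.dist_eq_one_iff_adj.1 h)
    have e4 : 0 < G.dist x y := hc.pos_dist_of_ne (by rintro rfl; omega)
    omega
  refine hG.not_isometric_hexagon y21.1 y31.1 y12.1 y32.1 y13.1 y23.1 d12 d13 d23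
    (dist_eq_two (u := b) hm hc n12 y13.1 y23.1 (by omega))
    (dist_eq_two (u := b) hm hc n13 y12.1 y32.1 (by omega))
    (dist_eq_two (u := b) hm hc n23 y21.1 y31.1 (by omega))
    (opposite d12 y12.1 (fun h => notAll j1 (by omega) h y12.1 y13.1) (by omega))
    (opposite d23 y23.1 (fun h => notAll j2 (by omega) y21.1 h y23.1) (by omega))
    (opposite (G.dist_comm.trans d23) y32.1
      (fun h => notAll j3 (by omega) y31.1 y32.1 h) (by omega))

lemma encard_lowerNeighbors_le (hG : HereditaryModular G)
    (hK : K23Free (G.induce (interval G b v))) {w : V} (hw : w ∈ interval G b v) :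
    (lowerNeighbors G b w).encard ≤ 2 := by
  by_contra! h
  obtain ⟨t, ht, hcard⟩ := Set.exists_subset_encard_eq (Order.add_one_le_of_lt h)
  norm_num at hcard
  obtain ⟨x, y, z, hxy, hxz, hyz, rfl⟩ := Set.encard_eq_three.1 hcard
  exact lowerNeighbors_not_three hG hK hw (ht (by simp)) (ht (by simp)) (ht (by simp))
    hxy hxz hyz

lemma finite_lowerNeighbors (hG : HereditaryModular G)
    (hK : K23Free (G.induce (interval G b v))) {w : V} (hw : w ∈ interval G b v) :
    (lowerNeighbors G b w).Finite :=
  Set.finite_of_encard_le_coe (k := 2) (encard_lowerNeighbors_le hG hK hw)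

lemma ncard_lowerNeighbors_le (hG : HereditaryModular G)
    (hK : K23Free (G.induce (interval G b v))) {w : V} (hw : w ∈ interval G b v) :
    (lowerNeighbors G b w).ncard ≤ 2 := by
  have h := encard_lowerNeighbors_le hG hK hw
  rw [← (finite_lowerNeighbors hG hK hw).cast_ncard_eq] at h
  exact_mod_cast h

lemma ncard_lowerNeighbors_pos (hG : HereditaryModular G)
    (hK : K23Free (G.induce (interval G b v))) {w : V} (hw : w ∈ interval G b v)
    (h : w ≠ b) : 0 < (lowerNeighbors G b w).ncard :=
  (Set.ncard_pos (finite_lowerNeighbors hG hK hw)).2 (lowerNeighbors_nonempty hG.1 h)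

lemma ncard_lowerNeighbors_self (G : SimpleGraph V) (b : V) :
    (lowerNeighbors G b b).ncard = 0 := by
  simp [lowerNeighbors]

lemma ncard_lowerNeighbors_eq_zero_iff (hG : HereditaryModular G)
    (hK : K23Free (G.induce (interval G b v))) {w : V} (hw : w ∈ interval G b v) :
    (lowerNeighbors G b w).ncard = 0 ↔ w = b := by
  constructor
  · intro h
    by_contra hne
    exact (ncard_lowerNeighbors_pos hG hK hw hne).ne' h
  · rintro rfl
    exact ncard_lowerNeighbors_self G w

lemma rho_eq (hc : G.Connected) {w : V} (hw : w ∈ interval G b v) :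
    rho G b v w = (lowerNeighbors G b w).ncard := by
  exact congrArg Set.ncard (Set.ext fun x =>
    ⟨fun h => h.2, fun h => ⟨(mem_interval_of_mem_lowerNeighbors hc hw h).1, h⟩⟩)

lemma mem_lowerNeighbors_swap (hc : G.Connected) {w x : V} (hw : w ∈ interval G b v)
    (hx : x ∈ lowerNeighbors G b w) : w ∈ lowerNeighbors G v x := by
  refine ⟨hx.1.symm, ?_⟩
  rw [G.dist_comm, G.dist_comm (u := v), (mem_interval_of_mem_lowerNeighbors hc hw hx).2]

lemma finite_interval (hG : HereditaryModular G)
    (hK : K23Free (G.induce (interval G b v))) : (interval G b v).Finite := by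
  have hlayer : ∀ k, {w | w ∈ interval G b v ∧ G.dist v w = k}.Finite := by
    intro k
    induction k with
    | zero =>
      refine (Set.finite_singleton v).subset ?_
      rintro w ⟨-, hw⟩
      exact (hG.1.dist_eq_zero_iff.1 hw).symm
    | succ k ih =>
      refine (ih.biUnion fun w hw => finite_lowerNeighbors hG hK hw.1).subset ?_
      rintro w ⟨hw, hk⟩
      obtain ⟨z, hz, hzk⟩ := exists_adj_dist_succ hG.1 hk
      have hz' : z ∈ lowerNeighbors G v w := ⟨hz, by omega⟩
      rw [← interval_comm] at hw
      have h1 := (mem_interval_of_mem_lowerNeighbors hG.1 hw hz').1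
      rw [interval_comm] at h1
      exact Set.mem_biUnion ⟨h1, hzk⟩ (mem_lowerNeighbors_swap hG.1 hw hz')
  refine ((Finset.range (G.dist b v + 1)).finite_toSet.biUnion fun k _ => hlayer k).subset ?_
  intro w hw
  refine Set.mem_biUnion (x := G.dist v w) ?_ ⟨hw, rfl⟩
  simp only [interval, Set.mem_ofPred_eq, G.dist_comm (v := v)] at hw ⊢
  simp only [G.dist_comm (u := v), Finset.coe_range, Set.mem_Iio] at hw ⊢
  omega

end Interval

section Counting

variable {V : Type*} {G : SimpleGraph V} {b v : V}

open Classical in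
lemma card_layer_branching_le (hG : HereditaryModular G)
    (hK : K23Free (G.induce (interval G b v))) (I : Finset V)
    (hI : ∀ w, w ∈ I ↔ w ∈ interval G b v) (n : ℕ) :
    (I.filter fun w => G.dist w v = n ∧ (lowerNeighbors G b w).ncard = 2).card ≤
      (I.filter fun z => G.dist z v = n + 2 ∧ (lowerNeighbors G v z).ncard = 2).card := by
  have hc := hG.1
  have hK' : K23Free (G.induce (interval G v b)) := by rwa [interval_comm]
  have hfin : ∀ {z}, z ∈ interval G b v → (lowerNeighbors G v z).Finite := fun hz =>
    finite_lowerNeighbors hG hK' (by rwa [interval_comm])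
  refine Finset.card_le_card_of_forall_subsingleton
    (fun w z => ∃ x y, x ≠ y ∧ x ∈ lowerNeighbors G b w ∧ y ∈ lowerNeighbors G b w ∧
      z ∈ lowerNeighbors G b x ∧ z ∈ lowerNeighbors G b y) ?_ ?_
  · intro w hw
    obtain ⟨hwI, hwn, hw2⟩ := Finset.mem_filter.1 hw
    rw [hI] at hwI
    obtain ⟨x, y, hx, hy, hxy⟩ :=
      (Set.one_lt_ncard_iff (finite_lowerNeighbors hG hK hwI)).1 (by omega)
    obtain ⟨z, hzx, hzy⟩ := exists_common_lowerNeighbor hG.hasMedians hc hxy hx hy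
    obtain ⟨ix, dx⟩ := mem_interval_of_mem_lowerNeighbors hc hwI hx
    obtain ⟨iy, -⟩ := mem_interval_of_mem_lowerNeighbors hc hwI hy
    obtain ⟨iz, dz⟩ := mem_interval_of_mem_lowerNeighbors hc ix hzx
    refine ⟨z, Finset.mem_filter.2 ⟨(hI z).2 iz, by omega, ?_⟩, x, y, hxy, hx, hy, hzx, hzy⟩
    refine le_antisymm (ncard_lowerNeighbors_le hG hK' (by rwa [interval_comm])) ?_
    exact (Set.one_lt_ncard_iff (hfin iz)).2
      ⟨x, y, mem_lowerNeighbors_swap hc ix hzx, mem_lowerNeighbors_swap hc iy hzy, hxy⟩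
  · intro z hz w hw w' hw'
    obtain ⟨hzI, -, hz2⟩ := Finset.mem_filter.1 hz
    rw [hI] at hzI
    obtain ⟨hwA, x, y, hxy, hx, hy, hzx, hzy⟩ := hw
    obtain ⟨hwA', x', y', hxy', hx', hy', hzx', hzy'⟩ := hw'
    have iw := (hI w).1 (Finset.mem_filter.1 hwA).1
    have iw' := (hI w').1 (Finset.mem_filter.1 hwA').1
    have ix := (mem_interval_of_mem_lowerNeighbors hc iw hx).1
    have iy := (mem_interval_of_mem_lowerNeighbors hc iw hy).1
    have ix' := (mem_interval_of_mem_lowerNeighbors hc iw' hx').1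
    have iy' := (mem_interval_of_mem_lowerNeighbors hc iw' hy').1
    have zx := mem_lowerNeighbors_swap hc ix hzx
    have zy := mem_lowerNeighbors_swap hc iy hzy
    have hpair : ({x', y'} : Set V) = lowerNeighbors G v z := by
      refine Set.eq_of_subset_of_ncard_le ?_ ?_ (hfin hzI)
      · rintro t (rfl | rfl)
        exacts [mem_lowerNeighbors_swap hc ix' hzx', mem_lowerNeighbors_swap hc iy' hzy']
      · rw [hz2, Set.ncard_pair hxy']
    have hsub : ∀ t ∈ lowerNeighbors G v z, w' ∈ lowerNeighbors G v t := by
      rw [← hpair]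
      rintro t (rfl | rfl)
      exacts [mem_lowerNeighbors_swap hc iw' hx', mem_lowerNeighbors_swap hc iw' hy']
    exact eq_of_mem_lowerNeighbors hc hK' (by rwa [interval_comm]) hxy zx zy
      ⟨mem_lowerNeighbors_swap hc iw hx, mem_lowerNeighbors_swap hc iw hy⟩
      ⟨hsub x zx, hsub y zy⟩

open Classical in
lemma card_layer_branching (hG : HereditaryModular G)
    (hK : K23Free (G.induce (interval G b v))) (I : Finset V)
    (hI : ∀ w, w ∈ I ↔ w ∈ interval G b v) {n : ℕ} (hn : n + 2 ≤ G.dist b v) :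
    (I.filter fun w => G.dist w v = n ∧ (lowerNeighbors G b w).ncard = 2).card =
      (I.filter fun z => G.dist z v = n + 2 ∧ (lowerNeighbors G v z).ncard = 2).card := by
  refine le_antisymm (card_layer_branching_le hG hK I hI n) ?_
  have h := card_layer_branching_le (b := v) (v := b) hG (by rwa [interval_comm]) I
    (by rwa [interval_comm]) (G.dist b v - (n + 2))
  have hd : ∀ w ∈ I, G.dist w b + G.dist w v = G.dist b v := fun w hw => by
    rw [G.dist_comm (u := w) (v := b)]
    exact (hI w).1 hw
  have hfilter : ∀ (f : V → Set V) (m m' : ℕ), m + m' = G.dist b v →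
      (I.filter fun w => G.dist w b = m ∧ (f w).ncard = 2) =
        I.filter fun w => G.dist w v = m' ∧ (f w).ncard = 2 := fun f m m' hm =>
    Finset.filter_congr fun w hw => and_congr_left fun _ => by have := hd w hw; omega
  rwa [hfilter _ _ (n + 2) (by omega), hfilter _ _ n (by omega)] at h

open Classical in
lemma card_edges_between_layers (hG : HereditaryModular G)
    (hK : K23Free (G.induce (interval G b v))) (I : Finset V)
    (hI : ∀ w, w ∈ I ↔ w ∈ interval G b v) {n : ℕ} (hn : n < G.dist b v) :
    (I.filter fun w => G.dist w v = n).card +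
        (I.filter fun w => G.dist w v = n ∧ (lowerNeighbors G b w).ncard = 2).card =
      (I.filter fun w => G.dist w v = n + 1).card +
        (I.filter fun w => G.dist w v = n + 1 ∧ (lowerNeighbors G v w).ncard = 2).card := by
  have hc := hG.1
  have hK' : K23Free (G.induce (interval G v b)) := by rwa [interval_comm]
  have hd : ∀ w ∈ I, G.dist b w + G.dist w v = G.dist b v := fun w hw => (hI w).1 hw
  have count : ∀ (s : Finset V) (f : V → ℕ), (∀ w ∈ s, 0 < f w ∧ f w ≤ 2) →
      ∑ w ∈ s, f w = s.card + (s.filter fun w => f w = 2).card := by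
    intro s f hf
    rw [Finset.card_filter, Finset.card_eq_sum_ones, ← Finset.sum_add_distrib]
    refine Finset.sum_congr rfl fun w hw => ?_
    have := hf w hw
    split_ifs <;> omega
  have h := Finset.sum_card_bipartiteAbove_eq_sum_card_bipartiteBelow
    (s := I.filter fun w => G.dist w v = n) (t := I.filter fun w => G.dist w v = n + 1) G.Adj
  have h1 : ∀ w ∈ I.filter (fun w => G.dist w v = n),
      ((I.filter fun w => G.dist w v = n + 1).bipartiteAbove G.Adj w).card =
        (lowerNeighbors G b w).ncard := by
    intro w hw
    obtain ⟨hwI, hwn⟩ := Finset.mem_filter.1 hw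
    rw [← Set.ncard_coe_finset]
    congr 1
    ext x
    simp only [Finset.mem_coe, Finset.mem_bipartiteAbove, Finset.mem_filter]
    constructor
    · rintro ⟨⟨hx, hxn⟩, hadj⟩
      have := hd w hwI
      have := hd x hx
      exact ⟨hadj, by omega⟩
    · intro hx
      obtain ⟨h1, h2⟩ := mem_interval_of_mem_lowerNeighbors hc ((hI w).1 hwI) hx
      exact ⟨⟨(hI x).2 h1, by omega⟩, hx.1⟩
  have h2 : ∀ x ∈ I.filter (fun w => G.dist w v = n + 1),
      ((I.filter fun w => G.dist w v = n).bipartiteBelow G.Adj x).card =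
        (lowerNeighbors G v x).ncard := by
    intro x hx
    obtain ⟨hxI, hxn⟩ := Finset.mem_filter.1 hx
    rw [← Set.ncard_coe_finset]
    congr 1
    ext w
    simp only [Finset.mem_coe, Finset.mem_bipartiteBelow, Finset.mem_filter]
    constructor
    · rintro ⟨⟨hw, hwn⟩, hadj⟩
      refine ⟨hadj.symm, ?_⟩
      rw [G.dist_comm, G.dist_comm (u := v)]
      omega
    · intro hw
      have hm := mem_interval_of_mem_lowerNeighbors (b := v) (v := b) hc
        (by rw [interval_comm]; exact (hI x).1 hxI) hw
      rw [interval_comm] at hm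
      have := hw.2
      rw [G.dist_comm, G.dist_comm (u := v)] at this
      exact ⟨⟨(hI w).2 hm.1, by omega⟩, hw.1.symm⟩
  rw [Finset.sum_congr rfl h1, Finset.sum_congr rfl h2, count, count, Finset.filter_filter,
    Finset.filter_filter] at h
  · exact h
  · intro x hx
    obtain ⟨hxI, hxn⟩ := Finset.mem_filter.1 hx
    have hi : x ∈ interval G v b := by rw [interval_comm]; exact (hI x).1 hxI
    refine ⟨ncard_lowerNeighbors_pos hG hK' hi ?_, ncard_lowerNeighbors_le hG hK' hi⟩
    rintro rfl
    simp at hxn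
  · intro w hw
    obtain ⟨hwI, hwn⟩ := Finset.mem_filter.1 hw
    have hi := (hI w).1 hwI
    refine ⟨ncard_lowerNeighbors_pos hG hK hi ?_, ncard_lowerNeighbors_le hG hK hi⟩
    rintro rfl
    omega

open Classical in
/-- Each layer of the interval, together with `b` as soon as the layers have passed it, has one
more element than the previous layer has elements with two lower neighbours. -/
lemma card_layer_succ (hG : HereditaryModular G)
    (hK : K23Free (G.induce (interval G b v))) (I : Finset V)
    (hI : ∀ w, w ∈ I ↔ w ∈ interval G b v) (n : ℕ) :
    (I.filter fun w => G.dist w v = n + 1).card + (if G.dist b v < n + 1 then 1 else 0) =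
      1 + (I.filter fun w => G.dist w v = n ∧ (lowerNeighbors G b w).ncard = 2).card := by
  have hd : ∀ w ∈ I, G.dist b w + G.dist w v = G.dist b v := fun w hw => (hI w).1 hw
  by_cases hn : G.dist b v ≤ n
  · rw [if_pos (by omega), Finset.filter_false_of_mem, Finset.filter_false_of_mem]
    · simp
    · rintro w hw ⟨hwn, hw2⟩
      have := hd w hw
      have : G.dist b w = 0 := by omega
      rw [← hG.1.dist_eq_zero_iff.1 this, ncard_lowerNeighbors_self] at hw2
      omega
    · intro w hw hwn
      have := hd w hw
      omega
  rw [if_neg (by omega), add_zero]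
  push Not at hn
  induction n with
  | zero =>
    have h := card_edges_between_layers hG hK I hI hn
    have hB : (I.filter fun w => G.dist w v = 0 + 1 ∧ (lowerNeighbors G v w).ncard = 2) = ∅ := by
      refine Finset.filter_false_of_mem ?_
      rintro w hw ⟨hw1, hw2⟩
      have hle : lowerNeighbors G v w ⊆ {v} := by
        rintro x ⟨hadj, hx⟩
        rw [G.dist_comm (u := v) (v := w)] at hx
        exact (hG.1.dist_eq_zero_iff.1 (by omega : G.dist v x = 0)).symm
      have := Set.ncard_le_ncard hle
      rw [Set.ncard_singleton] at this
      omega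
    have hL : (I.filter fun w => G.dist w v = 0) = {v} := by
      ext w
      rw [Finset.mem_filter, Finset.mem_singleton, hG.1.dist_eq_zero_iff, hI]
      refine ⟨fun h => h.2, ?_⟩
      rintro rfl
      simp [interval]
    rw [hB, hL, Finset.card_singleton, Finset.card_empty] at h
    omega
  | succ n ih =>
    have h := card_edges_between_layers hG hK I hI hn
    have h' := card_layer_branching hG hK I hI (n := n) (by omega)
    rw [show n + 2 = n + 1 + 1 from rfl] at h'
    have := ih (by omega)
    omega

end Counting

section Weight

variable {V : Type*} {G : SimpleGraph V} {b v : V}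

lemma weight_of_notMem {w : V} (n : ℕ) (hw : w ∉ interval G b v) : weight G b v n w = 0 :=
  if_pos (Or.inl hw)

lemma weight_of_mem (hc : G.Connected) {w : V} (n : ℕ) (hw : w ∈ interval G b v) :
    weight G b v n w =
      if n < G.dist w v then 0
      else if 2 ≤ (lowerNeighbors G b w).ncard then 1
      else if (lowerNeighbors G b w).ncard = 1 then n - G.dist w v + 1
      else (n - G.dist w v + 2) * (n - G.dist w v + 1) / 2 := by
  simp only [weight, hw, not_true_eq_false, false_or, rho_eq hc hw]

lemma triangle_succ (m : ℕ) :
    (m + 1 + 2) * (m + 1 + 1) / 2 = (m + 2) * (m + 1) / 2 + (m + 2) := by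
  rw [show (m + 1 + 2) * (m + 1 + 1) = (m + 2) * (m + 1) + (m + 2) * 2 by ring,
    Nat.add_mul_div_right _ _ (by norm_num)]

lemma weight_mono (hc : G.Connected) (n : ℕ) (w : V) :
    weight G b v n w ≤ weight G b v (n + 1) w := by
  by_cases hw : w ∈ interval G b v
  · rw [weight_of_mem hc n hw, weight_of_mem hc (n + 1) hw]
    by_cases h : n < G.dist w v
    · rw [if_pos h]
      exact Nat.zero_le _
    · rw [if_neg h, if_neg (show ¬ n + 1 < G.dist w v by omega),
        show n + 1 - G.dist w v = n - G.dist w v + 1 by omega,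
        triangle_succ]
      split_ifs <;> omega
  · rw [weight_of_notMem n hw]
    exact Nat.zero_le _

lemma weight_zero (hG : HereditaryModular G)
    (hK : K23Free (G.induce (interval G b v))) {w : V} (hw : w ∈ interval G b v) :
    weight G b v 0 w = if G.dist w v = 0 then 1 else 0 := by
  rw [weight_of_mem hG.1 0 hw]
  have := ncard_lowerNeighbors_le hG hK hw
  by_cases h : G.dist w v = 0
  · simp [h]
  · rw [if_pos (show 0 < G.dist w v by omega), if_neg h]

open Classical in
lemma ite_eq_basepoint (hG : HereditaryModular G)
    (hK : K23Free (G.induce (interval G b v))) {w : V} (hw : w ∈ interval G b v) (m : ℕ) :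
    (if w = b then (if G.dist b v < m then 1 else 0) else 0) =
      if (lowerNeighbors G b w).ncard = 0 ∧ G.dist w v < m then 1 else 0 := by
  simp only [ncard_lowerNeighbors_eq_zero_iff hG hK hw]
  by_cases h : w = b <;> simp [h]

open Classical in
lemma weight_one (hG : HereditaryModular G)
    (hK : K23Free (G.induce (interval G b v))) {w : V} (hw : w ∈ interval G b v) :
    weight G b v 1 w +
        (if G.dist w v = 0 ∧ (lowerNeighbors G b w).ncard = 2 then 1 else 0) =
      2 * weight G b v 0 w + (if G.dist w v = 0 + 1 then 1 else 0) +
        (if w = b then (if G.dist b v < 0 + 1 then 1 else 0) else 0) := by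
  have h2 := ncard_lowerNeighbors_le hG hK hw
  rw [ite_eq_basepoint hG hK hw, weight_zero hG hK hw, weight_of_mem hG.1 _ hw]
  generalize (lowerNeighbors G b w).ncard = r at *
  generalize G.dist w v = k at *
  obtain rfl | rfl | h : k = 0 ∨ k = 1 ∨ 1 < k := by omega
  all_goals norm_num
  all_goals split_ifs <;> omega

open Classical in
/-- The second difference of the weight function in its parameter. -/
lemma weight_second_difference (hG : HereditaryModular G)
    (hK : K23Free (G.induce (interval G b v))) (n : ℕ) {w : V} (hw : w ∈ interval G b v) :
    weight G b v (n + 2) w + weight G b v n w +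
        (if G.dist w v = n + 1 ∧ (lowerNeighbors G b w).ncard = 2 then 1 else 0) =
      2 * weight G b v (n + 1) w + (if G.dist w v = n + 1 + 1 then 1 else 0) +
        (if w = b then (if G.dist b v < n + 1 + 1 then 1 else 0) else 0) := by
  have h2 := ncard_lowerNeighbors_le hG hK hw
  rw [ite_eq_basepoint hG hK hw]
  simp only [weight_of_mem hG.1 _ hw]
  generalize (lowerNeighbors G b w).ncard = r at *
  generalize G.dist w v = k at *
  rcases lt_trichotomy k (n + 1) with h | rfl | h
  · obtain ⟨m, rfl⟩ := Nat.exists_eq_add_of_le (Nat.lt_succ_iff.1 h)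
    have e1 := triangle_succ m
    have e2 := triangle_succ (m + 1)
    rw [show k + m + 2 - k = m + 1 + 1 by omega, show k + m + 1 - k = m + 1 by omega,
      show k + m - k = m by omega]
    split_ifs <;> omega
  · rw [show n + 2 - (n + 1) = 1 by omega, Nat.sub_self]
    split_ifs <;> omega
  · obtain rfl | h := eq_or_ne k (n + 2)
    · rw [Nat.sub_self]
      split_ifs <;> omega
    · split_ifs <;> omega

/-- The total mass of the weight function is the triangular number `(n + 1)(n + 2) / 2`. -/
lemma two_mul_sum_weight (hG : HereditaryModular G)
    (hK : K23Free (G.induce (interval G b v))) (I : Finset V)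
    (hI : ∀ w, w ∈ I ↔ w ∈ interval G b v) (n : ℕ) :
    2 * ∑ w ∈ I, weight G b v n w = (n + 1) * (n + 2) := by
  classical
  have hbI : b ∈ I := (hI b).2 (by simp [interval])
  have hvI : v ∈ I := (hI v).2 (by simp [interval])
  have hcount := card_layer_succ hG hK I hI
  have hF0 : ∑ w ∈ I, weight G b v 0 w = 1 := by
    rw [Finset.sum_congr rfl fun w hw => weight_zero hG hK ((hI w).1 hw)]
    simp [hG.1.dist_eq_zero_iff, hvI]
  have hF1 : ∑ w ∈ I, weight G b v 1 w = 3 := by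
    have h := Finset.sum_congr rfl fun w hw => weight_one hG hK ((hI w).1 hw)
    simp only [Finset.sum_add_distrib, ← Finset.mul_sum, Finset.sum_ite_eq', hbI, if_true,
      ← Finset.card_filter] at h
    have := hcount 0
    omega
  have hstep : ∀ n, ∑ w ∈ I, weight G b v (n + 2) w + ∑ w ∈ I, weight G b v n w =
      2 * ∑ w ∈ I, weight G b v (n + 1) w + 1 := by
    intro n
    have h := Finset.sum_congr rfl fun w hw => weight_second_difference hG hK n ((hI w).1 hw)
    simp only [Finset.sum_add_distrib, ← Finset.mul_sum, Finset.sum_ite_eq', hbI, if_true,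
      ← Finset.card_filter] at h
    have := hcount (n + 1)
    omega
  induction n using Nat.twoStepInduction with
  | zero => rw [hF0]
  | one => rw [hF1]
  | more n ih1 ih2 =>
    have := hstep n
    nlinarith

lemma mem_interval_succ (hc : G.Connected) {v' w : V} (hadj : G.Adj v v')
    (hd : G.dist b v' = G.dist b v + 1) (hw : w ∈ interval G b v) :
    w ∈ interval G b v' ∧ G.dist w v' = G.dist w v + 1 := by
  have h1 := dist_le_succ_of_adj hc w hadj
  have h2 := hc.dist_triangle (u := b) (v := w) (w := v')
  simp only [interval, Set.mem_ofPred_eq] at hw ⊢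
  omega

lemma weight_succ_endpoint (hc : G.Connected) {v' w : V} (hadj : G.Adj v v')
    (hd : G.dist b v' = G.dist b v + 1) (hw : w ∈ interval G b v) (n : ℕ) :
    weight G b v' (n + 1) w = weight G b v n w := by
  obtain ⟨hw', hdw⟩ := mem_interval_succ hc hadj hd hw
  rw [weight_of_mem hc _ hw, weight_of_mem hc _ hw', hdw, Nat.add_sub_add_right]
  simp only [add_lt_add_iff_right]

/-- The pointwise minimum of the two weight functions is the weight function with
parameter decreased by one. -/
lemma abs_weight_sub (hc : G.Connected) {v' : V} (hadj : G.Adj v v')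
    (hd : G.dist b v' = G.dist b v + 1) (n : ℕ) (w : V) :
    |(weight G b v (n + 1) w : ℤ) - weight G b v' (n + 1) w| =
      weight G b v (n + 1) w + weight G b v' (n + 1) w - 2 * weight G b v n w := by
  by_cases hw : w ∈ interval G b v
  · have := weight_mono (b := b) (v := v) hc n w
    rw [weight_succ_endpoint hc hadj hd hw, abs_of_nonneg (by omega)]
    ring
  · simp [weight_of_notMem _ hw]

lemma abs_weight_sub_zero (hc : G.Connected) {v' : V} (hadj : G.Adj v v')
    (hd : G.dist b v' = G.dist b v + 1) (w : V) :
    |(weight G b v 0 w : ℤ) - weight G b v' 0 w| =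
      weight G b v 0 w + weight G b v' 0 w := by
  by_cases hw : w ∈ interval G b v
  · obtain ⟨hw', hdw⟩ := mem_interval_succ hc hadj hd hw
    have : weight G b v' 0 w = 0 := if_pos (Or.inr (by omega))
    simp [this]
  · simp [weight_of_notMem _ hw]

end Weight

/-- In a hereditary modular graph with `K_{2,3}`-free intervals `I(b,v)` and `I(b,v')`,
for adjacent `v, v'` with `d(b,v') = d(b,v) + 1`, `‖f_{n,v} - f_{n,v'}‖₁ = 2(n+1)`. -/
theorem weight_difference_l1_norm {V : Type*} (G : SimpleGraph V)
    (hG : HereditaryModular G) (b v v' : V)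
    (hadj : G.Adj v v') (hd : G.dist b v' = G.dist b v + 1)
    (hv : K23Free (G.induce (interval G b v)))
    (hv' : K23Free (G.induce (interval G b v'))) (n : ℕ) :
    (Function.support (fun w => (weight G b v n w : ℤ) - (weight G b v' n w : ℤ))).Finite ∧
      ∑ᶠ w, |(weight G b v n w : ℤ) - (weight G b v' n w : ℤ)| = 2 * (n + 1) := by
  classical
  have hc := hG.1
  set I := (finite_interval hG hv).toFinset
  set I' := (finite_interval hG hv').toFinset
  have hI : ∀ w, w ∈ I ↔ w ∈ interval G b v := fun w => Set.Finite.mem_toFinset _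
  have hI' : ∀ w, w ∈ I' ↔ w ∈ interval G b v' := fun w => Set.Finite.mem_toFinset _
  have hsub : I ⊆ I' := fun w hw =>
    (hI' w).2 (mem_interval_succ hc hadj hd ((hI w).1 hw)).1
  have hzero : ∀ w, w ∉ I' → (weight G b v n w : ℤ) - weight G b v' n w = 0 := by
    intro w hw
    rw [weight_of_notMem n fun h => hw (hsub ((hI w).2 h)),
      weight_of_notMem n fun h => hw ((hI' w).2 h), sub_self]
  have hsupp : (Function.support
      fun w => (weight G b v n w : ℤ) - (weight G b v' n w : ℤ)) ⊆ I' :=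
    fun w hw => by_contra fun h => hw (hzero w h)
  refine ⟨I'.finite_toSet.subset hsupp, ?_⟩
  rw [finsum_eq_sum_of_support_subset (s := I') _ fun w hw => hsupp fun h =>
    hw (by simp only at h ⊢; rw [h, abs_zero])]
  have hmass : ∀ m, (2 : ℤ) * ∑ w ∈ I', (weight G b v m w : ℤ) = (m + 1) * (m + 2) := by
    intro m
    rw [← Finset.sum_subset hsub fun w _ hw => by
      rw [weight_of_notMem m fun h => hw ((hI w).2 h), Nat.cast_zero]]
    exact_mod_cast two_mul_sum_weight hG hv I hI m
  have hmass' : (2 : ℤ) * ∑ w ∈ I', (weight G b v' n w : ℤ) = (n + 1) * (n + 2) := by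
    exact_mod_cast two_mul_sum_weight hG hv' I' hI' n
  have h1 := hmass n
  cases n with
  | zero =>
    simp only [abs_weight_sub_zero hc hadj hd, Finset.sum_add_distrib]
    push_cast at h1 hmass' ⊢
    linarith
  | succ n =>
    have h2 := hmass n
    simp only [abs_weight_sub hc hadj hd, Finset.sum_sub_distrib, Finset.sum_add_distrib,
      ← Finset.mul_sum]
    push_cast at h1 hmass' ⊢
    linarith
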